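/- Let n ≥ 1, let m₁,…,mₙ be positive integers, and let k₁,…,kₙ be integers with 0 ≤ k_j ≤ m_j − 1 for each j. Let h be a holomorphic function on (Δ*)ⁿ, and define G on (Δ*)ⁿ by G(t₁,…,tₙ) := h(t₁^{m₁},…,tₙ^{mₙ}) · ∏_{j=1}^{n} t_j^{m_j − 1 − k_j}. If G extends to a holomorphic function on Δⁿ, then h extends to a holomorphic function on Δⁿ. -/

import Mathlib

open MeasureTheory Metric

open Set Filter Topology Function Complex

/-- A circle integral of a jointly holomorphic function is holomorphic in the parameter. -/
lemma differentiableAt_circleIntegral_of_differentiableOn {V : Type*} [NormedAddCommGroup V]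
    [NormedSpace ℂ V] [FiniteDimensional ℂ V] {Φ : V × ℂ → ℂ} {Ω : Set (V × ℂ)} (hΩ : IsOpen Ω)
    (hΦ : DifferentiableOn ℂ Φ Ω) {x₀ : V} {c : ℂ} {R : ℝ} (hR : 0 ≤ R)
    (hsub : ∀ ζ ∈ sphere c R, (x₀, ζ) ∈ Ω) :
    DifferentiableAt ℂ (fun x => circleIntegral (fun ζ => Φ (x, ζ)) c R) x₀ := by
  let : MeasurableSpace V := borel V
  have : BorelSpace V := ⟨rfl⟩
  have : ProperSpace V := FiniteDimensional.proper ℂ V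
  have hK : IsCompact ({x₀} ×ˢ sphere c R : Set (V × ℂ)) :=
    isCompact_singleton.prod (isCompact_sphere c R)
  have hKΩ : ({x₀} ×ˢ sphere c R : Set (V × ℂ)) ⊆ Ω := by
    rintro ⟨x, ζ⟩ ⟨rfl, hζ⟩
    exact hsub ζ hζ
  obtain ⟨W, hKW, hW, hbdd⟩ :=
    exists_isOpen_isBounded_image_of_isCompact_of_continuousOn hK hΩ hKΩ hΦ.continuousOn
  obtain ⟨C, hC⟩ := isBounded_iff_forall_norm_le.1 hbdd
  obtain ⟨δ, hδ, hthick⟩ :=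
    hK.exists_thickening_subset_open (hW.inter hΩ) (subset_inter hKW hKΩ)
  have hball : ∀ x ∈ ball x₀ (δ / 2), ∀ ζ ∈ sphere c R, ball (x, ζ) (δ / 2) ⊆ W ∩ Ω := by
    intro x hx ζ hζ p hp
    refine hthick (mem_thickening_iff.2 ⟨(x₀, ζ), ⟨rfl, hζ⟩, ?_⟩)
    calc dist p (x₀, ζ) ≤ dist p (x, ζ) + dist (x, ζ) (x₀, ζ) := dist_triangle _ _ _
      _ < δ / 2 + δ / 2 := add_lt_add hp (by rwa [dist_prod_same_right])
      _ = δ := add_halves δ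
  have hmem : ∀ x ∈ ball x₀ (δ / 2), ∀ ζ ∈ sphere c R, (x, ζ) ∈ Ω := fun x hx ζ hζ =>
    (hball x hx ζ hζ (mem_ball_self (half_pos hδ))).2
  have hfd : ∀ x ∈ ball x₀ (δ / 2), ∀ ζ ∈ sphere c R,
      ‖fderiv ℂ Φ (x, ζ)‖ ≤ (C + C) / (δ / 2) := by
    intro x hx ζ hζ
    refine norm_fderiv_le_div_of_mapsTo_ball (hΦ.mono ((hball x hx ζ hζ).trans inter_subset_right))
      (fun p hp => ?_) (half_pos hδ)
    rw [mem_closedBall, dist_eq_norm_sub]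
    exact norm_sub_le_of_le (hC _ (mem_image_of_mem _ (hball x hx ζ hζ hp).1))
      (hC _ (mem_image_of_mem _ (hball x hx ζ hζ (mem_ball_self (half_pos hδ))).1))
  have hcont : ∀ x ∈ ball x₀ (δ / 2),
      Continuous fun θ => deriv (circleMap c R) θ • Φ (x, circleMap c R θ) := by
    intro x hx
    have h1 : Continuous fun θ => Φ (x, circleMap c R θ) :=
      hΦ.continuousOn.comp_continuous (by fun_prop)
        fun θ => hmem x hx _ (circleMap_mem_sphere c hR θ)
    have h2 : Continuous fun θ => deriv (circleMap c R) θ := by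
      simp only [deriv_circleMap]
      fun_prop
    exact h2.smul h1
  have key := intervalIntegral.hasFDerivAt_integral_of_dominated_of_fderiv_le (𝕜 := ℂ)
    (μ := volume) (a := 0) (b := 2 * Real.pi) (x₀ := x₀) (s := ball x₀ (δ / 2))
    (F := fun x θ => deriv (circleMap c R) θ • Φ (x, circleMap c R θ))
    (F' := fun x θ => deriv (circleMap c R) θ •
      (fderiv ℂ Φ (x, circleMap c R θ)).comp (ContinuousLinearMap.inl ℂ V ℂ))
    (bound := fun _ => |R| * ((C + C) / (δ / 2) * ‖ContinuousLinearMap.inl ℂ V ℂ‖))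
    (ball_mem_nhds _ (half_pos hδ)) ?_ ?_ ?_ ?_ ?_ ?_
  · exact key.differentiableAt
  · filter_upwards [ball_mem_nhds x₀ (half_pos hδ)] with x hx
    exact (hcont x hx).aestronglyMeasurable
  · exact (hcont x₀ (mem_ball_self (half_pos hδ))).intervalIntegrable _ _
  · have h1 : Measurable fun θ : ℝ => fderiv ℂ Φ (x₀, circleMap c R θ) :=
      (measurable_fderiv ℂ Φ).comp (by fun_prop : Continuous fun θ : ℝ =>
        ((x₀, circleMap c R θ) : V × ℂ)).measurable
    have h2 : Continuous fun L : V × ℂ →L[ℂ] ℂ => L.comp (ContinuousLinearMap.inl ℂ V ℂ) := by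
      fun_prop
    have h3 : Continuous fun θ => deriv (circleMap c R) θ := by
      simp only [deriv_circleMap]
      fun_prop
    exact h3.aestronglyMeasurable.smul
      (h2.comp_aestronglyMeasurable h1.aestronglyMeasurable)
  · refine Eventually.of_forall fun θ _ x hx => ?_
    rw [norm_smul]
    have h1 : ‖deriv (circleMap c R) θ‖ = |R| := by simp [deriv_circleMap]
    rw [h1]
    gcongr
    refine (ContinuousLinearMap.opNorm_comp_le _ _).trans ?_
    gcongr
    exact hfd x hx _ (circleMap_mem_sphere c hR θ)
  · simp
  · refine Eventually.of_forall fun θ _ x hx => ?_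
    have hd : HasFDerivAt Φ (fderiv ℂ Φ (x, circleMap c R θ)) (x, circleMap c R θ) :=
      (hΦ.differentiableAt
        (hΩ.mem_nhds (hmem x hx _ (circleMap_mem_sphere c hR θ)))).hasFDerivAt
    have hinl : HasFDerivAt (fun y : V => (y, circleMap c R θ))
        (ContinuousLinearMap.inl ℂ V ℂ) x := hasFDerivAt_prodMk_left x _
    exact (hd.comp x hinl).const_smul (deriv (circleMap c R) θ)

/-- A holomorphic function on the punctured unit disk with `ζ f(ζ) → 0` at `0` satisfies Cauchy's
integral formula. -/
lemma circleIntegral_sub_inv_mul_of_tendsto_mul_zero {f : ℂ → ℂ}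
    (hf : DifferentiableOn ℂ f (ball 0 1 \ {0}))
    (hlim : Tendsto (fun ζ => ζ * f ζ) (𝓝[≠] 0) (𝓝 0)) {w : ℂ} {r : ℝ} (hw : w ≠ 0)
    (hwr : ‖w‖ < r) (hr : r < 1) :
    circleIntegral (fun ζ => (ζ - w)⁻¹ * f ζ) 0 r = 2 * Real.pi * I * f w := by
  have hr0 : 0 < r := (norm_nonneg w).trans_lt hwr
  have ho : (fun z => f z - f 0) =o[𝓝[≠] 0] fun z => (z - 0)⁻¹ := by
    rw [Asymptotics.isLittleO_iff_tendsto']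
    · have h1 : Tendsto (fun ζ : ℂ => ζ * f 0) (𝓝[≠] 0) (𝓝 0) := by
        have : Continuous fun ζ : ℂ => ζ * f 0 := by fun_prop
        simpa using (this.tendsto 0).mono_left nhdsWithin_le_nhds
      refine (by simpa using hlim.sub h1 :
        Tendsto (fun ζ => ζ * f ζ - ζ * f 0) (𝓝[≠] 0) (𝓝 0)).congr fun ζ => ?_
      simp only [sub_zero, div_inv_eq_mul]
      ring
    · filter_upwards [self_mem_nhdsWithin] with ζ hζ h0
      simp_all
  have hd := differentiableOn_update_limUnder_of_isLittleO (ball_mem_nhds 0 one_pos) hf ho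
  have hcauchy := (hd.mono (closedBall_subset_ball hr)).circleIntegral_sub_inv_smul
    (w := w) (by simpa using hwr)
  rw [update_of_ne hw, smul_eq_mul] at hcauchy
  rw [← hcauchy]
  refine circleIntegral.integral_congr hr0.le fun ζ hζ => ?_
  have : ζ ≠ 0 := ne_zero_of_mem_sphere hr0.ne' ⟨ζ, hζ⟩
  simp [this]

/-- The points of the open unit polydisk whose coordinates outside `s` do not vanish. -/
def puncturedPolydisk {ι : Type*} (s : Finset ι) : Set (ι → ℂ) :=
  {z | ∀ i, ‖z i‖ < 1 ∧ (i ∉ s → z i ≠ 0)}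

section

variable {ι : Type*}

lemma puncturedPolydisk_mono {s t : Finset ι} (h : s ⊆ t) :
    puncturedPolydisk s ⊆ puncturedPolydisk t :=
  fun _ hz i => ⟨(hz i).1, fun hi => (hz i).2 fun his => hi (h his)⟩

lemma puncturedPolydisk_empty :
    puncturedPolydisk (∅ : Finset ι) = Set.univ.pi fun _ => ball (0 : ℂ) 1 \ {0} := by
  ext z
  simp [puncturedPolydisk, Set.mem_pi]

lemma puncturedPolydisk_univ [Fintype ι] :
    puncturedPolydisk (Finset.univ : Finset ι) = Set.univ.pi fun _ => ball (0 : ℂ) 1 := by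
  ext z
  simp [puncturedPolydisk, Set.mem_pi]

lemma isOpen_puncturedPolydisk [Finite ι] (s : Finset ι) : IsOpen (puncturedPolydisk s) := by
  simp only [puncturedPolydisk, Set.ofPred_forall, Set.ofPred_and]
  refine isOpen_iInter_of_finite fun i => IsOpen.inter ?_ (isOpen_iInter_of_finite fun _ => ?_)
  · exact isOpen_lt (by fun_prop) continuous_const
  · exact isOpen_ne_fun (by fun_prop) continuous_const

variable [DecidableEq ι]

lemma update_mem_puncturedPolydisk {s : Finset ι} {j : ι} {z : ι → ℂ}
    (hz : z ∈ puncturedPolydisk (insert j s)) {ζ : ℂ} (hζ : ζ ∈ ball (0 : ℂ) 1 \ {0}) :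
    update z j ζ ∈ puncturedPolydisk s := by
  intro i
  rcases eq_or_ne i j with rfl | hij
  · simpa using ⟨by simpa using hζ.1, fun _ => hζ.2⟩
  · simpa [hij] using hz i

variable [Fintype ι]

/-- Extension of a holomorphic function across the hyperplane `z j = 0`. -/
lemma exists_extension_puncturedPolydisk_insert {s : Finset ι} (j : ι) {H : (ι → ℂ) → ℂ}
    (hH : DifferentiableOn ℂ H (puncturedPolydisk s))
    (hlim : ∀ z ∈ puncturedPolydisk (∅ : Finset ι),
      Tendsto (fun ζ => ζ * H (update z j ζ)) (𝓝[≠] 0) (𝓝 0)) :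
    ∃ H' : (ι → ℂ) → ℂ, DifferentiableOn ℂ H' (puncturedPolydisk (insert j s)) ∧
      EqOn H' H (puncturedPolydisk ∅) := by
  have hupd : Differentiable ℂ fun p : (ι → ℂ) × ℂ => update p.1 j p.2 := by
    rw [differentiable_pi]
    intro i
    rcases eq_or_ne i j with rfl | hij
    · simp only [update_self]
      fun_prop
    · simp only [update_of_ne hij]
      fun_prop
  set Φ : (ι → ℂ) × ℂ → ℂ := fun p => (p.2 - p.1 j)⁻¹ * H (update p.1 j p.2) with hΦdef
  set Ω : Set ((ι → ℂ) × ℂ) :=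
    {p | p.2 - p.1 j ≠ 0} ∩ (fun p => update p.1 j p.2) ⁻¹' puncturedPolydisk s with hΩdef
  have hΩ : IsOpen Ω := (isOpen_ne_fun (by fun_prop) continuous_const).inter
    ((isOpen_puncturedPolydisk s).preimage hupd.continuous)
  have hΦ : DifferentiableOn ℂ Φ Ω := by
    refine DifferentiableOn.mul (DifferentiableOn.inv (by fun_prop) fun p hp => hp.1) ?_
    exact hH.comp hupd.differentiableOn fun p hp => hp.2
  have hmem : ∀ z ∈ puncturedPolydisk (insert j s), ∀ ζ : ℂ, ‖z j‖ < ‖ζ‖ → ‖ζ‖ < 1 →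
      (z, ζ) ∈ Ω := by
    intro z hz ζ h1 h2
    refine ⟨sub_ne_zero.2 fun h => ?_, update_mem_puncturedPolydisk hz ⟨by simpa using h2, ?_⟩⟩
    · simp_all
    · rintro rfl
      simp only [norm_zero] at h1
      exact (norm_nonneg _).not_gt h1
  have hradius : ∀ z ∈ puncturedPolydisk (insert j s), ∀ r R : ℝ, ‖z j‖ < r → r ≤ R → R < 1 →
      circleIntegral (fun ζ => Φ (z, ζ)) 0 R = circleIntegral (fun ζ => Φ (z, ζ)) 0 r := by
    intro z hz r R h1 h2 h3
    have hd : ∀ ζ ∈ closedBall (0 : ℂ) R \ ball 0 r,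
        DifferentiableAt ℂ (fun ζ => Φ (z, ζ)) ζ := by
      intro ζ hζ
      simp only [Set.mem_sdiff, mem_closedBall, dist_zero_right, mem_ball, not_lt] at hζ
      have := hΦ.differentiableAt (hΩ.mem_nhds (hmem z hz ζ (h1.trans_le hζ.2) (hζ.1.trans_lt h3)))
      exact this.comp ζ (by fun_prop : DifferentiableAt ℂ (fun ζ : ℂ => (z, ζ)) ζ)
    refine circleIntegral_eq_of_differentiable_on_annulus_off_countable
      ((norm_nonneg _).trans_lt h1) h2 countable_empty
      (fun ζ hζ => (hd ζ hζ).continuousAt.continuousWithinAt) fun ζ hζ => hd ζ ?_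
    exact ⟨ball_subset_closedBall hζ.1.1, fun h => hζ.1.2 (ball_subset_closedBall h)⟩
  refine ⟨fun z => (2 * Real.pi * I)⁻¹ *
    circleIntegral (fun ζ => Φ (z, ζ)) 0 ((1 + ‖z j‖) / 2), ?_, ?_⟩
  · intro z₀ hz₀
    have hz₀j := (hz₀ j).1
    have hd : DifferentiableAt ℂ
        (fun z => circleIntegral (fun ζ => Φ (z, ζ)) 0 ((1 + ‖z₀ j‖) / 2)) z₀ := by
      refine differentiableAt_circleIntegral_of_differentiableOn hΩ hΦ (by positivity) fun ζ hζ => ?_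
      rw [mem_sphere_zero_iff_norm] at hζ
      exact hmem z₀ hz₀ ζ (by linarith) (by linarith)
    refine ((hd.const_mul (2 * Real.pi * I)⁻¹).congr_of_eventuallyEq ?_).differentiableWithinAt
    have hev : ∀ᶠ z : ι → ℂ in 𝓝 z₀, ‖z j‖ < (1 + ‖z₀ j‖) / 2 :=
      (by fun_prop : Continuous fun z : ι → ℂ => ‖z j‖).continuousAt.eventually_lt_const
        (by linarith)
    filter_upwards [hev, (isOpen_puncturedPolydisk _).mem_nhds hz₀] with z hz hzD
    have hzj := (hzD j).1
    congr 1
    rcases le_total ‖z j‖ ‖z₀ j‖ with hle | hle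
    · exact (hradius z hzD _ _ (by linarith) (by linarith) (by linarith)).symm
    · exact hradius z hzD _ _ hz (by linarith) (by linarith)
  · intro z hz
    have hzj := (hz j).1
    have hsub : DifferentiableOn ℂ (fun ζ => H (update z j ζ)) (ball 0 1 \ {0}) := by
      refine hH.comp (hupd.comp (by fun_prop : Differentiable ℂ
        fun ζ : ℂ => (z, ζ))).differentiableOn fun ζ hζ => ?_
      exact update_mem_puncturedPolydisk (puncturedPolydisk_mono (Finset.empty_subset _) hz) hζ
    have := circleIntegral_sub_inv_mul_of_tendsto_mul_zero hsub (hlim z hz) (w := z j)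
      (r := (1 + ‖z j‖) / 2) ((hz j).2 (Finset.notMem_empty j)) (by linarith) (by linarith)
    simp only [hΦdef]
    rw [this, update_eq_self, inv_mul_cancel_left₀ two_pi_I_ne_zero]

/-- A holomorphic function on the punctured polydisk with `z j * h z → 0` as one coordinate
`z j` tends to `0` extends to the polydisk. -/
lemma exists_extension_polydisk {h : (ι → ℂ) → ℂ}
    (hh : DifferentiableOn ℂ h (puncturedPolydisk ∅))
    (hlim : ∀ j, ∀ z ∈ puncturedPolydisk (∅ : Finset ι),
      Tendsto (fun ζ => ζ * h (update z j ζ)) (𝓝[≠] 0) (𝓝 0)) (s : Finset ι) :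
    ∃ H : (ι → ℂ) → ℂ, DifferentiableOn ℂ H (puncturedPolydisk s) ∧
      EqOn H h (puncturedPolydisk ∅) := by
  induction s using Finset.induction_on with
  | empty => exact ⟨h, hh, fun _ _ => rfl⟩
  | insert j s _ ih =>
    obtain ⟨H, hH, hHh⟩ := ih
    obtain ⟨H', hH', hH'H⟩ := exists_extension_puncturedPolydisk_insert j hH fun z hz => by
      refine (hlim j z hz).congr' ?_
      filter_upwards [sdiff_mem_nhdsWithin_compl (ball_mem_nhds (0 : ℂ) one_pos) {0}] with ζ hζ
      rw [hHh (update_mem_puncturedPolydisk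
        (puncturedPolydisk_mono (Finset.empty_subset _) hz) hζ)]
    exact ⟨H', hH', hH'H.trans hHh⟩

/-- If `h (t ^ m) * ∏ t i ^ a i` extends holomorphically, with `a i < m i`, then `z j * h z`
tends to `0` with the coordinate `z j`. -/
lemma tendsto_mul_update_of_pow_pullback {m a : ι → ℕ} (ham : ∀ i, a i < m i)
    {h G : (ι → ℂ) → ℂ} (hG : ContinuousOn G (puncturedPolydisk Finset.univ))
    (hGeq : ∀ t ∈ puncturedPolydisk (∅ : Finset ι),
      G t = h (fun i => t i ^ m i) * ∏ i, t i ^ a i)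
    (j : ι) {z : ι → ℂ} (hz : z ∈ puncturedPolydisk (∅ : Finset ι)) :
    Tendsto (fun ζ => ζ * h (update z j ζ)) (𝓝[≠] 0) (𝓝 0) := by
  have hm : ∀ i, m i ≠ 0 := fun i => (Nat.zero_le _).trans_lt (ham i) |>.ne'
  set root : ι → ℂ → ℂ := fun i w => w ^ ((m i : ℂ)⁻¹) with hroot
  have root_pow : ∀ i w, root i w ^ m i = w := fun i w => cpow_nat_inv_pow w (hm i)
  have root_norm : ∀ i w, ‖w‖ < 1 → ‖root i w‖ < 1 := by
    intro i w hw
    rw [← pow_lt_one_iff_of_nonneg (norm_nonneg _) (hm i), ← norm_pow, root_pow]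
    exact hw
  have root_ne : ∀ i w, w ≠ 0 → root i w ≠ 0 := by
    intro i w hw h0
    apply hw
    rw [← root_pow i w, h0, zero_pow (hm i)]
  have root_lim : Tendsto (root j) (𝓝[≠] 0) (𝓝 0) := by
    have hpos : 0 < ((m j : ℂ)⁻¹).re := by
      rw [← ofReal_natCast, ← ofReal_inv, ofReal_re]
      have := Nat.pos_of_ne_zero (hm j)
      positivity
    have h1 : ContinuousAt (root j) 0 :=
      continuousAt_cpow_const_of_re_pos (by simp) hpos
    have h2 := h1.tendsto.mono_left (nhdsWithin_le_nhds (s := {0}ᶜ))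
    rwa [show root j 0 = 0 by simp [hroot, hm j]] at h2
  set t : ι → ℂ := fun i => root i (z i) with ht
  have htmem : t ∈ puncturedPolydisk (∅ : Finset ι) := fun i =>
    ⟨root_norm i _ (hz i).1, fun hi => root_ne i _ ((hz i).2 hi)⟩
  set C : ℂ := ∏ i ∈ Finset.univ \ {j}, t i ^ a i with hC
  have hC0 : C ≠ 0 := Finset.prod_ne_zero_iff.2 fun i _ =>
    pow_ne_zero _ ((htmem i).2 (Finset.notMem_empty i))
  have hG0 : Tendsto (fun ζ => G (update t j (root j ζ))) (𝓝[≠] 0) (𝓝 (G (update t j 0))) := by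
    have hmem0 : update t j 0 ∈ puncturedPolydisk Finset.univ := by
      intro i
      rcases eq_or_ne i j with rfl | hij
      · simp
      · simpa [hij] using (htmem i).1
    have h1 : ContinuousAt G (update t j 0) :=
      hG.continuousAt ((isOpen_puncturedPolydisk _).mem_nhds hmem0)
    have h2 : Tendsto (update t j) (𝓝 0) (𝓝 (update t j 0)) :=
      (continuous_const.update j continuous_id).tendsto 0
    exact h1.tendsto.comp (h2.comp root_lim)
  have hprod : Tendsto (fun ζ => G (update t j (root j ζ)) * root j ζ ^ (m j - a j) * C⁻¹)
      (𝓝[≠] 0) (𝓝 0) := by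
    have := (hG0.mul (root_lim.pow (m j - a j))).mul_const C⁻¹
    rwa [zero_pow (Nat.sub_pos_of_lt (ham j)).ne', mul_zero, zero_mul] at this
  refine hprod.congr' ?_
  filter_upwards [sdiff_mem_nhdsWithin_compl (ball_mem_nhds (0 : ℂ) one_pos) {0}] with ζ hζ
  have hroot_mem : root j ζ ∈ ball (0 : ℂ) 1 \ {0} :=
    ⟨by simpa using root_norm j ζ (by simpa using hζ.1), root_ne j ζ hζ.2⟩
  have hpow : (fun i => update t j (root j ζ) i ^ m i) = update z j ζ := by
    ext i
    rcases eq_or_ne i j with rfl | hij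
    · simp [root_pow]
    · simp [hij, ht, root_pow]
  have hupdprod : ∏ i, update t j (root j ζ) i ^ a i = root j ζ ^ a j * C := by
    rw [← Finset.mul_prod_erase _ _ (Finset.mem_univ j), update_self, hC,
      Finset.sdiff_singleton_eq_erase]
    congr 1
    refine Finset.prod_congr rfl fun i hi => ?_
    rw [update_of_ne (Finset.ne_of_mem_erase hi)]
  rw [hGeq _ (update_mem_puncturedPolydisk
    (puncturedPolydisk_mono (Finset.empty_subset _) htmem) hroot_mem), hpow, hupdprod]
  calc h (update z j ζ) * (root j ζ ^ a j * C) * root j ζ ^ (m j - a j) * C⁻¹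
      = (root j ζ ^ a j * root j ζ ^ (m j - a j)) * h (update z j ζ) * (C * C⁻¹) := by ring
    _ = ζ * h (update z j ζ) := by
      rw [← pow_add, Nat.add_sub_cancel' (ham j).le, root_pow, mul_inv_cancel₀ hC0, mul_one]

end

/-- Let `n ≥ 1`, let `m₁, …, mₙ` be positive integers and `0 ≤ kⱼ ≤ mⱼ - 1`.
Let `h` be holomorphic on `(Δ*)ⁿ` and set `G(t) := h(t₁^{m₁}, …, tₙ^{mₙ}) · ∏ⱼ tⱼ^{mⱼ-1-kⱼ}`
on `(Δ*)ⁿ`. If `G` extends to a holomorphic function on `Δⁿ`, then so does `h`. -/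
theorem stmt_6 (n : ℕ) (hn : 1 ≤ n) (m : Fin n → ℕ) (hm : ∀ j, 1 ≤ m j)
    (κ : Fin n → ℤ) (hκ : ∀ j, 0 ≤ κ j ∧ κ j ≤ (m j : ℤ) - 1)
    (h : (Fin n → ℂ) → ℂ)
    (hh : DifferentiableOn ℂ h (Set.univ.pi fun _ : Fin n => ball (0 : ℂ) 1 \ {0}))
    (G : (Fin n → ℂ) → ℂ)
    (hG : DifferentiableOn ℂ G (Set.univ.pi fun _ : Fin n => ball (0 : ℂ) 1))
    (hGeq : ∀ t ∈ (Set.univ.pi fun _ : Fin n => ball (0 : ℂ) 1 \ {0}),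
      G t = h (fun j => t j ^ m j) * ∏ j, t j ^ ((m j : ℤ) - 1 - κ j)) :
    ∃ H : (Fin n → ℂ) → ℂ,
      DifferentiableOn ℂ H (Set.univ.pi fun _ : Fin n => ball (0 : ℂ) 1) ∧
      Set.EqOn H h (Set.univ.pi fun _ : Fin n => ball (0 : ℂ) 1 \ {0}) := by
  rw [← puncturedPolydisk_empty] at hh hGeq ⊢
  rw [← puncturedPolydisk_univ] at hG ⊢
  refine exists_extension_polydisk hh (fun j z hz => ?_) _
  refine tendsto_mul_update_of_pow_pullback (m := m) (a := fun i => ((m i : ℤ) - 1 - κ i).toNat)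
    (fun i => ?_) hG.continuousOn (fun t ht => ?_) j hz
  · have := hκ i
    have := hm i
    lia
  · rw [hGeq t ht]
    congr 1
    refine Finset.prod_congr rfl fun i _ => ?_
    rw [← zpow_natCast, Int.toNat_of_nonneg (by linarith [(hκ i).2])]
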